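/- For α ∈ (0,1), the nth moment of the M-Wright function satisfies ∫_0^∞ z Φ_α(z) dz = 1/Γ(α+1), where Φ_α(z) = Σ_{n=0}^∞ (-z)^n/(n! Γ(1-α(n+1))); more generally ∫_0^∞ z^n Φ_α(z) dz = Γ(n+1)/Γ(αn+1) for each integer n ≥ 0. -/

import Mathlib

open MeasureTheory Real

lemma mw_norm_exp (θ x r : ℝ) :
    ‖Complex.exp (-((x:ℂ) * Complex.exp ((θ:ℂ) * Complex.I)) * (r:ℂ))‖
      = Real.exp (-(x * Real.cos θ) * r) := by
  rw [Complex.norm_exp]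
  congr 1
  simp [Complex.exp_ofReal_mul_I_re]

lemma mw_int (p q b : ℝ) (hp : 0 < p) (hq : -1 < q) (hb : 0 < b) :
    Integrable (fun r : ℝ => r^q * Real.exp (-b * r^p)) (volume.restrict (Set.Ioi 0)) :=
  integrableOn_rpow_mul_exp_neg_mul_rpow hq hp hb

lemma mw_int1 (q b : ℝ) (hq : -1 < q) (hb : 0 < b) :
    Integrable (fun r : ℝ => r^q * Real.exp (-b * r)) (volume.restrict (Set.Ioi 0)) := by
  simpa using mw_int 1 q b one_pos hq hb

lemma mw_meas (q : ℝ) (w : ℂ) : Measurable (fun r : ℝ => ((r^q : ℝ) : ℂ) * Complex.exp (-w * (r:ℂ))) := by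
  fun_prop

lemma mw_laplace_diff (s : ℝ) (hs : 0 < s) (w : ℂ) (hw : 0 < w.re) :
    DifferentiableAt ℂ (fun w : ℂ => ∫ r in Set.Ioi (0:ℝ), ((r^(s-1) : ℝ) : ℂ) *
      Complex.exp (-w * (r:ℂ))) w := by
  have hnorm : ∀ (v : ℂ) (r : ℝ), ‖Complex.exp (-v * (r:ℂ))‖ = Real.exp (-v.re * r) := by
    intro v r; rw [Complex.norm_exp]; simp
  refine (hasDerivAt_integral_of_dominated_loc_of_deriv_le (s := {v : ℂ | w.re / 2 < v.re})
    (F' := fun v (r:ℝ) => ((r^(s-1) : ℝ) : ℂ) * (Complex.exp (-v * (r:ℂ)) * (-1 * (r:ℂ))))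
    (bound := fun r => r ^ s * Real.exp (-(w.re/2) * r)) ?_ ?_ ?_ ?_ ?_ ?_ ?_).2.differentiableAt
  · exact (isOpen_lt continuous_const Complex.continuous_re).mem_nhds (by simpa using by linarith)
  · exact Filter.Eventually.of_forall fun v => (mw_meas _ v).aestronglyMeasurable
  · refine (mw_int1 (s-1) w.re (by linarith) hw).mono' (mw_meas _ w).aestronglyMeasurable ?_
    filter_upwards [ae_restrict_mem measurableSet_Ioi] with r hr
    have hr' : (0:ℝ) < r := hr
    rw [norm_mul, hnorm, Complex.norm_real, Real.norm_of_nonneg (by positivity)]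
  · exact Measurable.aestronglyMeasurable (by fun_prop)
  · filter_upwards [ae_restrict_mem measurableSet_Ioi] with r hr v hv
    have hr' : (0:ℝ) < r := hr
    have hv' : w.re / 2 < v.re := hv
    rw [norm_mul, norm_mul, hnorm, Complex.norm_real, Real.norm_of_nonneg (by positivity)]
    rw [norm_mul, Complex.norm_real, Real.norm_of_nonneg hr'.le]
    simp only [norm_neg, norm_one, one_mul]
    rw [mul_comm (Real.exp _), ← mul_assoc, ← Real.rpow_add_one hr'.ne', sub_add_cancel]
    gcongr
  · exact mw_int1 s _ (by linarith) (by linarith)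
  · refine Filter.Eventually.of_forall fun r v _ => ?_
    exact ((((hasDerivAt_id v).neg.mul_const (r:ℂ)).cexp).const_mul _)

lemma mw_laplace (s : ℝ) (hs : 0 < s) (w : ℂ) (hw : 0 < w.re) :
    ∫ r in Set.Ioi (0:ℝ), ((r^(s-1) : ℝ) : ℂ) * Complex.exp (-w * (r:ℂ))
      = w ^ (-(s:ℂ)) * (Real.Gamma s : ℂ) := by
  have hopen : IsOpen {v : ℂ | 0 < v.re} := isOpen_lt continuous_const Complex.continuous_re
  have hf : AnalyticOnNhd ℂ (fun w : ℂ => ∫ r in Set.Ioi (0:ℝ), ((r^(s-1) : ℝ) : ℂ) *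
      Complex.exp (-w * (r:ℂ))) {v : ℂ | 0 < v.re} :=
    DifferentiableOn.analyticOnNhd
      (fun v hv => (mw_laplace_diff s hs v hv).differentiableWithinAt) hopen
  have hg : AnalyticOnNhd ℂ (fun w : ℂ => w ^ (-(s:ℂ)) * (Real.Gamma s : ℂ)) {v : ℂ | 0 < v.re} :=
    DifferentiableOn.analyticOnNhd (fun v hv => by
      have : v ∈ Complex.slitPlane := Or.inl hv
      exact ((differentiableAt_id.cpow_const this).mul_const _).differentiableWithinAt) hopen
  refine hf.eqOn_of_preconnected_of_frequently_eq hg (convex_halfSpace_re_gt 0).isPreconnected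
    (z₀ := 1) (by simp) ?_ hw
  have ht : Filter.Tendsto (fun x : ℝ => (x:ℂ)) (nhdsWithin 1 {1}ᶜ) (nhdsWithin 1 {1}ᶜ) := by
    refine tendsto_nhdsWithin_iff.2 ⟨?_, ?_⟩
    · exact (Complex.continuous_ofReal.tendsto' 1 1 (by simp)).mono_left nhdsWithin_le_nhds
    · filter_upwards [self_mem_nhdsWithin] with x hx
      simpa using hx
  refine ht.frequently (Filter.Eventually.frequently ?_)
  filter_upwards [nhdsWithin_le_nhds (Ioi_mem_nhds (zero_lt_one' ℝ))] with x hx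
  have hx' : (0:ℝ) < x := hx
  have key := Real.integral_rpow_mul_exp_neg_mul_Ioi hs hx'
  rw [one_div, Real.inv_rpow hx'.le, ← Real.rpow_neg hx'.le] at key
  have k2 : (x:ℂ)^(-(s:ℂ)) = ((x^(-s) : ℝ) : ℂ) := by
    rw [Complex.ofReal_cpow hx'.le]; simp
  rw [k2, ← Complex.ofReal_mul, ← key, ← integral_complex_ofReal]
  congr 1
  ext r
  push_cast
  rw [neg_mul]

lemma mw_gam (θ x s : ℝ) (h1 : -(π/2) < θ) (h2 : θ < π/2) (hx : 0 < x) (hs : 0 < s) :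
    ∫ r in Set.Ioi (0:ℝ), ((r^(s-1) : ℝ) : ℂ) *
      Complex.exp (-((x:ℂ) * Complex.exp ((θ:ℂ) * Complex.I)) * (r:ℂ))
     = ((x^(-s) * Real.Gamma s : ℝ) : ℂ) * Complex.exp ((((-(s*θ)) : ℝ) : ℂ) * Complex.I) := by
  have hc : 0 < Real.cos θ := Real.cos_pos_of_mem_Ioo ⟨h1, h2⟩
  have key := mw_laplace s hs ((x:ℂ) * Complex.exp ((θ:ℂ) * Complex.I))
    (by simpa [Complex.exp_ofReal_mul_I_re] using mul_pos hx hc)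
  have e1 : ((x:ℂ) * Complex.exp ((θ:ℂ) * Complex.I)) ^ (-(s:ℂ))
      = ((x^(-s) : ℝ) : ℂ) * Complex.exp ((((-(s*θ)) : ℝ) : ℂ) * Complex.I) := by
    have : ((x:ℂ) * Complex.exp ((θ:ℂ) * Complex.I))
      = Complex.exp (((Real.log x : ℝ) : ℂ) + ((θ : ℝ) : ℂ) * Complex.I) := by
      rw [Complex.exp_add, ← Complex.ofReal_exp, Real.exp_log hx]
    rw [this, Complex.cpow_def_of_ne_zero (Complex.exp_ne_zero _), Complex.log_exp,
      Real.rpow_def_of_pos hx, Complex.ofReal_exp, ← Complex.exp_add]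
    · congr 1; push_cast; ring
    · simp; linarith [Real.pi_pos]
    · simp; linarith [Real.pi_pos]
  rw [key, e1]
  push_cast
  ring

lemma mw_taylor (K : ℕ) : ∀ w : ℂ, w.re ≤ 0 →
    ‖Complex.exp w - ∑ k ∈ Finset.range K, w^k / (k.factorial : ℂ)‖ ≤ ‖w‖^K := by
  induction K with
  | zero => intro w hw; simpa [Complex.norm_exp] using hw
  | succ K ih =>
    intro w hw
    have hconv : Convex ℝ ({z : ℂ | z.re ≤ 0} ∩ Metric.closedBall 0 ‖w‖) :=
      (convex_halfSpace_re_le 0).inter (convex_closedBall _ _)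
    have hd : ∀ z : ℂ, HasDerivAt
        (fun z : ℂ => Complex.exp z - ∑ k ∈ Finset.range (K+1), z^k / (k.factorial : ℂ))
        (Complex.exp z - ∑ k ∈ Finset.range K, z^k / (k.factorial : ℂ)) z := by
      intro z
      refine (Complex.hasDerivAt_exp z).sub ?_
      have := HasDerivAt.fun_sum (u := Finset.range (K+1))
        (A := fun k (z : ℂ) => z^k / (k.factorial : ℂ))
        (A' := fun k => (k : ℂ) * z^(k-1) / (k.factorial : ℂ)) (x := z)
        (fun k _ => (hasDerivAt_pow k z).div_const _)
      convert this using 1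
      rw [Finset.sum_range_succ']
      simp only [Nat.cast_zero, zero_mul, zero_div, add_zero, Nat.add_sub_cancel]
      refine Finset.sum_congr rfl fun k _ => ?_
      rw [Nat.factorial_succ]
      push_cast
      have : (k.factorial : ℂ) ≠ 0 := by exact_mod_cast k.factorial_ne_zero
      have : (k + 1 : ℂ) ≠ 0 := by exact_mod_cast k.succ_ne_zero
      field_simp
    have := hconv.norm_image_sub_le_of_norm_hasDerivWithin_le (C := ‖w‖^K)
      (fun z _ => (hd z).hasDerivWithinAt)
      (fun z hz => (ih z hz.1).trans (by
        have : ‖z‖ ≤ ‖w‖ := by simpa using hz.2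
        gcongr)) (x := 0) (y := w) (by simp) (by simpa using hw)
    simpa [Finset.sum_range_succ', pow_succ] using this

lemma mw_reflect (s : ℝ) (hs : 0 < s) :
    Real.Gamma s * Real.sin (π * s) = π * (Real.Gamma (1 - s))⁻¹ := by
  have h := Real.Gamma_mul_Gamma_one_sub s
  have hG := (Real.Gamma_pos_of_pos hs).ne'
  by_cases h0 : Real.sin (π * s) = 0
  · rw [h0, div_zero] at h
    have : Real.Gamma (1 - s) = 0 := by simpa [hG] using h
    simp [h0, this]
  · have : Real.Gamma (1 - s) ≠ 0 := by
      intro h1; rw [h1, mul_zero] at h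
      exact div_ne_zero Real.pi_ne_zero h0 h.symm
    rw [eq_div_iff h0] at h
    rw [← div_eq_mul_inv, eq_div_iff this]
    linarith

noncomputable def mwE (θ x r : ℝ) : ℂ :=
  Complex.exp (-((x:ℂ) * Complex.exp ((θ:ℂ) * Complex.I)) * (r:ℂ))

lemma mwE_norm (θ x r : ℝ) : ‖mwE θ x r‖ = Real.exp (-(x * Real.cos θ) * r) := mw_norm_exp θ x r

lemma mwE_cont : Continuous (fun p : ℝ × ℝ × ℝ => mwE p.1 p.2.1 p.2.2) := by
  unfold mwE; fun_prop

@[fun_prop]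
lemma mwE_meas {ι : Type*} [MeasurableSpace ι] (θ : ℝ) (f g : ι → ℝ) (hf : Measurable f)
    (hg : Measurable g) : Measurable (fun i => mwE θ (f i) (g i)) := by
  unfold mwE; fun_prop

lemma mwE_gam (θ x s : ℝ) (h1 : -(π/2) < θ) (h2 : θ < π/2) (hx : 0 < x) (hs : 0 < s) :
    ∫ r in Set.Ioi (0:ℝ), ((r^(s-1) : ℝ) : ℂ) * mwE θ x r
     = ((x^(-s) * Real.Gamma s : ℝ) : ℂ) * Complex.exp ((((-(s*θ)) : ℝ) : ℂ) * Complex.I) :=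
  mw_gam θ x s h1 h2 hx hs

noncomputable def mwH (α θ ψ z r : ℝ) : ℂ :=
  Complex.exp ((ψ:ℂ) * Complex.I) * (((r^(α-1) : ℝ) : ℂ) * mwE θ 1 r * mwE ψ z (r^α))

lemma mwH_meas (α θ ψ : ℝ) : Measurable (fun p : ℝ × ℝ => mwH α θ ψ p.1 p.2) := by
  unfold mwH; fun_prop

lemma mwH_meas1 (α θ ψ z : ℝ) : Measurable (fun r : ℝ => mwH α θ ψ z r) := by
  unfold mwH; fun_prop

lemma mwH_norm (α θ ψ z r : ℝ) (hr : 0 < r) : ‖mwH α θ ψ z r‖ =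
    r^(α-1) * Real.exp (-Real.cos θ * r) * Real.exp (-(z * Real.cos ψ) * r^α) := by
  unfold mwH
  rw [norm_mul, norm_mul, norm_mul, mwE_norm, mwE_norm, Complex.norm_exp_ofReal_mul_I,
    Complex.norm_real, Real.norm_of_nonneg (by positivity), one_mul, one_mul]

lemma mwH_bound (α θ ψ z r : ℝ) (hr : 0 < r) (hz : 0 ≤ z) (hψ : 0 < Real.cos ψ) :
    ‖mwH α θ ψ z r‖ ≤ r^(α-1) * Real.exp (-Real.cos θ * r) := by
  rw [mwH_norm α θ ψ z r hr]
  refine mul_le_of_le_one_right (by positivity) (Real.exp_le_one_iff.2 ?_)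
  have : 0 ≤ z * Real.cos ψ * r^α := by positivity
  linarith

lemma mwH_int (α θ ψ z : ℝ) (hα : 0 < α) (hθ : 0 < Real.cos θ) (hψ : 0 < Real.cos ψ)
    (hz : 0 ≤ z) : Integrable (mwH α θ ψ z) (volume.restrict (Set.Ioi 0)) := by
  refine (mw_int1 (α-1) (Real.cos θ) (by linarith) hθ).mono' (mwH_meas1 _ _ _ _).aestronglyMeasurable ?_
  filter_upwards [ae_restrict_mem measurableSet_Ioi] with r hr
  exact mwH_bound α θ ψ z r hr hz hψ

noncomputable def mwG (α θ ψ z : ℝ) : ℂ := ∫ r in Set.Ioi (0:ℝ), mwH α θ ψ z r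

lemma mwG_cont (α θ ψ : ℝ) (hα : 0 < α) (hθ : 0 < Real.cos θ) (hψ : 0 < Real.cos ψ) :
    ContinuousOn (mwG α θ ψ) (Set.Ioi 0) := by
  unfold mwG
  refine continuousOn_of_dominated (bound := fun r => r^(α-1) * Real.exp (-Real.cos θ * r))
    (fun z _ => (mwH_meas1 _ _ _ _).aestronglyMeasurable) (fun z hz => ?_)
    (mw_int1 (α-1) (Real.cos θ) (by linarith) hθ) (Filter.Eventually.of_forall fun r => ?_)
  · filter_upwards [ae_restrict_mem measurableSet_Ioi] with r hr
    exact mwH_bound α θ ψ z r hr (le_of_lt hz) hψ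
  · unfold mwH mwE; fun_prop

lemma mwG_bound (α θ ψ z : ℝ) (hα : 0 < α) (hθ : 0 < Real.cos θ) (hψ : 0 < Real.cos ψ)
    (hz : 0 ≤ z) : ‖mwG α θ ψ z‖ ≤ ∫ r in Set.Ioi (0:ℝ), r^(α-1) * Real.exp (-Real.cos θ * r) := by
  refine norm_integral_le_of_norm_le (mw_int1 (α-1) (Real.cos θ) (by linarith) hθ) ?_
  filter_upwards [ae_restrict_mem measurableSet_Ioi] with r hr
  exact mwH_bound α θ ψ z r hr hz hψ

lemma mw_young (α a z : ℝ) (hα : 0 < α) (hα1 : α < 1) (ha : 0 < a) (hz : 0 ≤ z) :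
    ∃ C : ℝ, ∀ r : ℝ, 0 < r → z * r^α ≤ C + a * r := by
  have ht : Filter.Tendsto (fun r : ℝ => z * r^(-(1-α))) Filter.atTop (nhds (z * 0)) :=
    (tendsto_rpow_neg_atTop (by linarith : 0 < 1 - α)).const_mul z
  rw [mul_zero] at ht
  obtain ⟨R, hR⟩ := Filter.eventually_atTop.1 (ht.eventually (gt_mem_nhds ha))
  refine ⟨z * (max R 1)^α, fun r hr => ?_⟩
  have hm : 0 < max R 1 := lt_of_lt_of_le one_pos (le_max_right _ _)
  rcases le_total r (max R 1) with h | h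
  · have : z * r^α ≤ z * (max R 1)^α := by gcongr
    nlinarith [mul_pos ha hr]
  · have h1 := hR r ((le_max_left _ _).trans h)
    have h2 : r^α = r^(-(1-α)) * r := by
      rw [← Real.rpow_add_one hr.ne']; congr 1; ring
    have : 0 ≤ z * (max R 1)^α := by positivity
    rw [h2]
    nlinarith

lemma mw_series (α θ ψ z : ℝ) (hα : 0 < α) (hα1 : α < 1) (h1 : -(π/2) < θ) (h2 : θ < π/2)
    (hψ : ψ = α * (θ + π)) (hz : 0 ≤ z) :
    ∑' n : ℕ, (-z) ^ n / ((n.factorial : ℝ) * Real.Gamma (1 - α * (n + 1)))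
      = (mwG α θ ψ z).im / π := by
  have hθ : 0 < Real.cos θ := Real.cos_pos_of_mem_Ioo ⟨h1, h2⟩
  have hs := hasSum_integral_of_dominated_convergence (μ := volume.restrict (Set.Ioi (0:ℝ)))
    (F := fun (n : ℕ) (r : ℝ) => Complex.exp ((ψ:ℂ) * Complex.I) *
      (((r^(α-1) : ℝ) : ℂ) * mwE θ 1 r *
        ((-((z:ℂ) * Complex.exp ((ψ:ℂ) * Complex.I)) * ((r^α : ℝ):ℂ))^n / (n.factorial : ℂ))))
    (f := mwH α θ ψ z)
    (fun n r => r^(α-1) * Real.exp (-Real.cos θ * r) * ((z * r^α)^n / (n.factorial : ℝ)))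
    ?_ ?_ ?_ ?_ ?_
  · have ht : ∀ n : ℕ, (∫ r in Set.Ioi (0:ℝ), Complex.exp ((ψ:ℂ) * Complex.I) *
      (((r^(α-1) : ℝ) : ℂ) * mwE θ 1 r *
        ((-((z:ℂ) * Complex.exp ((ψ:ℂ) * Complex.I)) * ((r^α : ℝ):ℂ))^n / (n.factorial : ℂ)))) =
        (((-z)^n / (n.factorial : ℝ) * Real.Gamma (α * (n+1)) : ℝ) : ℂ) *
          Complex.exp (((π * (α * (n+1)) : ℝ) : ℂ) * Complex.I) := by
      intro n
      have hg := mwE_gam θ 1 (α * (n+1)) h1 h2 one_pos (by positivity)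
      rw [Real.one_rpow, one_mul] at hg
      have : ∀ r ∈ Set.Ioi (0:ℝ), Complex.exp ((ψ:ℂ) * Complex.I) *
        (((r^(α-1) : ℝ) : ℂ) * mwE θ 1 r *
        ((-((z:ℂ) * Complex.exp ((ψ:ℂ) * Complex.I)) * ((r^α : ℝ):ℂ))^n / (n.factorial : ℂ)))
        = (Complex.exp ((ψ:ℂ) * Complex.I)^(n+1) * (-(z:ℂ))^n / (n.factorial : ℂ)) *
          (((r^(α * (n+1) - 1) : ℝ) : ℂ) * mwE θ 1 r) := by
        intro r hr
        have hr' : (0:ℝ) < r := hr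
        have e : r^(α * (n+1) - 1) = r^(α-1) * (r^α)^n := by
          rw [← Real.rpow_mul_natCast hr'.le, ← Real.rpow_add hr']; congr 1; ring
        rw [e]; push_cast; ring
      rw [setIntegral_congr_fun measurableSet_Ioi this, integral_const_mul, hg]
      have e2 : Complex.exp (((π * (α * (n+1)) : ℝ) : ℂ) * Complex.I) =
          Complex.exp ((ψ:ℂ) * Complex.I)^(n+1) *
          Complex.exp (((-(α * (n+1) * θ) : ℝ) : ℂ) * Complex.I) := by
        rw [← Complex.exp_nat_mul, ← Complex.exp_add, hψ]; congr 1; push_cast; ring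
      rw [e2]; push_cast; ring
    simp_rw [ht] at hs
    have hi := Complex.hasSum_im hs
    have : ∀ n : ℕ, ((((-z)^n / (n.factorial : ℝ) * Real.Gamma (α * (n+1)) : ℝ) : ℂ) *
          Complex.exp (((π * (α * (n+1)) : ℝ) : ℂ) * Complex.I)).im =
        π * ((-z) ^ n / ((n.factorial : ℝ) * Real.Gamma (1 - α * (n + 1)))) := by
      intro n
      rw [Complex.im_ofReal_mul, Complex.exp_ofReal_mul_I_im, mul_assoc,
        mw_reflect _ (by positivity), div_mul_eq_div_div]
      ring
    simp_rw [this] at hi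
    have hi2 := hi.tsum_eq
    rw [tsum_mul_left] at hi2
    rw [eq_div_iff Real.pi_ne_zero, mul_comm, hi2]
    rfl
  · intro n
    exact Measurable.aestronglyMeasurable (by fun_prop)
  · intro n
    filter_upwards [ae_restrict_mem measurableSet_Ioi] with r hr
    have hr' : (0:ℝ) < r := hr
    rw [norm_mul, norm_mul, norm_mul, mwE_norm, norm_div, norm_pow, norm_mul, norm_neg, norm_mul,
      Complex.norm_exp_ofReal_mul_I, Complex.norm_real, Complex.norm_real, Complex.norm_real,
      Complex.norm_natCast, Real.norm_of_nonneg (by positivity), Real.norm_of_nonneg hz,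
      Real.norm_of_nonneg (by positivity), one_mul, one_mul, mul_one]
  · refine Filter.Eventually.of_forall fun r => ?_
    exact (Real.summable_pow_div_factorial _).mul_left _
  · obtain ⟨C, hC⟩ := mw_young α (Real.cos θ / 2) z hα hα1 (by linarith) hz
    have hi := (mw_int1 (α-1) (Real.cos θ / 2) (by linarith) (by linarith)).const_mul (Real.exp C)
    have he : ∀ r : ℝ, ∑' n : ℕ, r^(α-1) * Real.exp (-Real.cos θ * r) *
        ((z * r^α)^n / (n.factorial : ℝ)) =
        r^(α-1) * Real.exp (-Real.cos θ * r) * Real.exp (z * r^α) := by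
      intro r
      rw [tsum_mul_left, Real.exp_eq_exp_ℝ, NormedSpace.exp_eq_tsum_div]
    simp_rw [he]
    refine hi.mono' (Measurable.aestronglyMeasurable (by fun_prop)) ?_
    filter_upwards [ae_restrict_mem measurableSet_Ioi] with r hr
    have hr' : (0:ℝ) < r := hr
    rw [Real.norm_of_nonneg (by positivity), mul_assoc, ← Real.exp_add, mul_left_comm,
      ← Real.exp_add]
    have := hC r hr'
    exact mul_le_mul_of_nonneg_left (Real.exp_le_exp.2 (by linarith)) (by positivity)
  · refine Filter.Eventually.of_forall fun r => ?_
    refine HasSum.mul_left _ (HasSum.mul_left _ ?_)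
    have := NormedSpace.expSeries_div_hasSum_exp
      (-((z:ℂ) * Complex.exp ((ψ:ℂ) * Complex.I)) * ((r^α : ℝ):ℂ))
    rwa [← Complex.exp_eq_exp_ℂ] at this

noncomputable def mwW (θ r : ℝ) : ℂ := -(((1:ℝ):ℂ) * Complex.exp ((θ:ℂ) * Complex.I)) * (r:ℂ)

noncomputable def mwT (α θ ψ z : ℝ) (k : ℕ) (r : ℝ) : ℂ :=
  Complex.exp ((ψ:ℂ) * Complex.I) *
    (((r^(α-1) : ℝ) : ℂ) * (mwW θ r ^ k / (k.factorial : ℂ)) * mwE ψ z (r^α))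

lemma mwW_norm (θ r : ℝ) (hr : 0 ≤ r) : ‖mwW θ r‖ = r := by
  unfold mwW
  rw [norm_mul, norm_neg, norm_mul, Complex.norm_exp_ofReal_mul_I, Complex.norm_real,
    Complex.norm_real, Real.norm_of_nonneg hr]
  simp

lemma mwW_re (θ r : ℝ) : (mwW θ r).re = - (Real.cos θ * r) := by
  unfold mwW; simp [Complex.exp_ofReal_mul_I_re]

lemma mwT_int (α θ ψ z : ℝ) (k : ℕ) (hα : 0 < α) (hψ : 0 < Real.cos ψ) (hz : 0 < z) :
    Integrable (mwT α θ ψ z k) (volume.restrict (Set.Ioi 0)) := by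
  have hi := (mw_int α (α - 1 + k) (z * Real.cos ψ) hα
    (by have : (0:ℝ) ≤ k := k.cast_nonneg
        linarith) (by positivity)).mul_const ((k.factorial : ℝ)⁻¹)
  refine hi.mono' ?_ ?_
  · refine Measurable.aestronglyMeasurable ?_
    unfold mwT mwW; fun_prop
  · filter_upwards [ae_restrict_mem measurableSet_Ioi] with r hr
    have hr' : (0:ℝ) < r := hr
    unfold mwT
    rw [norm_mul, norm_mul, norm_mul, norm_div, norm_pow, mwW_norm θ r hr'.le, mwE_norm,
      Complex.norm_exp_ofReal_mul_I, Complex.norm_real, Complex.norm_natCast,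
      Real.norm_of_nonneg (by positivity), Real.rpow_add_natCast hr'.ne']
    apply le_of_eq
    ring

lemma mwT_val (α θ ψ z : ℝ) (k : ℕ) (hα : 0 < α) (h1 : -(π/2) < ψ) (h2 : ψ < π/2)
    (hψ : ψ = α * (θ + π)) (hz : 0 < z) :
    (∫ r in Set.Ioi (0:ℝ), mwT α θ ψ z k r).im = 0 := by
  have hk : (0:ℝ) ≤ k := k.cast_nonneg
  have hg := mwE_gam ψ z (k/α+1) h1 h2 hz (by positivity)
  have : ∀ r ∈ Set.Ioi (0:ℝ), mwT α θ ψ z k r =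
      (Complex.exp ((ψ:ℂ) * Complex.I) * (-Complex.exp ((θ:ℂ) * Complex.I))^k
        / ((k.factorial : ℂ) * (α:ℂ))) *
      ((α * r^(α-1)) • ((((r^α)^((k:ℝ)/α+1-1) : ℝ) : ℂ) * mwE ψ z (r^α))) := by
    intro r hr
    have hr' : (0:ℝ) < r := hr
    have e : (r^α)^((k:ℝ)/α+1-1) = r^k := by
      rw [← Real.rpow_mul hr'.le, ← Real.rpow_natCast]; congr 1; field_simp; ring
    have ha : (α:ℂ) ≠ 0 := by exact_mod_cast hα.ne'
    have hf : (k.factorial : ℂ) ≠ 0 := by exact_mod_cast k.factorial_ne_zero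
    rw [e, Complex.real_smul]
    unfold mwT mwW
    push_cast
    rw [one_mul, mul_pow]
    field_simp
  rw [setIntegral_congr_fun measurableSet_Ioi this, integral_const_mul,
    integral_comp_rpow_Ioi_of_pos
      (g := fun y => (((y^((k:ℝ)/α+1-1) : ℝ) : ℂ) * mwE ψ z y)) hα, hg]
  have hneg : -Complex.exp ((θ:ℂ) * Complex.I) = Complex.exp (((θ:ℂ) + π) * Complex.I) := by
    rw [add_mul, Complex.exp_add, Complex.exp_pi_mul_I]; ring
  have hph : Complex.exp ((ψ:ℂ) * Complex.I) * (-Complex.exp ((θ:ℂ) * Complex.I))^k *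
      Complex.exp (((-((k/α+1)*ψ) : ℝ) : ℂ) * Complex.I) = 1 := by
    rw [hneg, ← Complex.exp_nat_mul, ← Complex.exp_add, ← Complex.exp_add, ← Complex.exp_zero]
    congr 1
    have ha : (α:ℂ) ≠ 0 := by exact_mod_cast hα.ne'
    rw [hψ]; push_cast; field_simp; ring
  have : Complex.exp ((ψ:ℂ) * Complex.I) * (-Complex.exp ((θ:ℂ) * Complex.I))^k
        / ((k.factorial : ℂ) * (α:ℂ)) *
      (((z^(-((k:ℝ)/α+1)) * Real.Gamma (k/α+1) : ℝ) : ℂ) *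
        Complex.exp (((-((k/α+1)*ψ) : ℝ) : ℂ) * Complex.I)) =
      ((z^(-((k:ℝ)/α+1)) * Real.Gamma (k/α+1) / (k.factorial * α) : ℝ) : ℂ) := by
    rw [div_mul_eq_mul_div, mul_left_comm, hph]
    push_cast
    ring
  rw [this, Complex.ofReal_im]

lemma mwG_decay (α θ ψ z : ℝ) (K : ℕ) (hα : 0 < α) (hθ : 0 < Real.cos θ)
    (h1 : -(π/2) < ψ) (h2 : ψ < π/2)
    (hψ : ψ = α * (θ + π)) (hz : 0 < z) :
    |(mwG α θ ψ z).im| ≤ (z * Real.cos ψ)^(-(α - 1 + K + 1) / α) * (1/α) *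
      Real.Gamma ((α - 1 + K + 1) / α) := by
  have hc : 0 < Real.cos ψ := Real.cos_pos_of_mem_Ioo ⟨h1, h2⟩
  have hK : (0:ℝ) ≤ K := K.cast_nonneg
  have hsum : Integrable (fun r => ∑ k ∈ Finset.range K, mwT α θ ψ z k r)
      (volume.restrict (Set.Ioi 0)) :=
    integrable_finsetSum _ fun k _ => mwT_int α θ ψ z k hα hc hz
  have e : (mwG α θ ψ z).im = (∫ r in Set.Ioi (0:ℝ),
      (mwH α θ ψ z r - ∑ k ∈ Finset.range K, mwT α θ ψ z k r)).im := by
    rw [integral_sub (mwH_int α θ ψ z hα hθ hc hz.le) hsum, Complex.sub_im,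
      integral_finsetSum _ fun k _ => mwT_int α θ ψ z k hα hc hz, Complex.im_sum,
      Finset.sum_eq_zero fun k _ => mwT_val α θ ψ z k hα h1 h2 hψ hz, sub_zero]
    rfl
  rw [e]
  refine (Complex.abs_im_le_norm _).trans ?_
  rw [← integral_rpow_mul_exp_neg_mul_rpow hα (by linarith) (by positivity)]
  refine norm_integral_le_of_norm_le
    (mw_int α (α - 1 + K) (z * Real.cos ψ) hα (by linarith) (by positivity)) ?_
  filter_upwards [ae_restrict_mem measurableSet_Ioi] with r hr
  have hr' : (0:ℝ) < r := hr
  have e2 : mwH α θ ψ z r - ∑ k ∈ Finset.range K, mwT α θ ψ z k r =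
      Complex.exp ((ψ:ℂ) * Complex.I) * (((r^(α-1) : ℝ) : ℂ) *
        (Complex.exp (mwW θ r) - ∑ k ∈ Finset.range K, mwW θ r ^ k / (k.factorial : ℂ)) *
        mwE ψ z (r^α)) := by
    unfold mwH mwT
    rw [← Finset.mul_sum, ← Finset.sum_mul, ← Finset.mul_sum, ← mul_sub, ← sub_mul, ← mul_sub]
    rfl
  have ht := mw_taylor K (mwW θ r) (by rw [mwW_re]; nlinarith [mul_pos hθ hr'])
  rw [mwW_norm θ r hr'.le] at ht
  rw [e2, norm_mul, norm_mul, norm_mul, mwE_norm, Complex.norm_exp_ofReal_mul_I, Complex.norm_real,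
      Real.norm_of_nonneg (by positivity), Real.rpow_add_natCast hr'.ne', one_mul]
  gcongr

lemma mwE_symm (θ x y : ℝ) : mwE θ x y = mwE θ y x := by
  unfold mwE; congr 1; ring

lemma mw_fub_int (α θ ψ s : ℝ) (hα : 0 < α) (hθ : 0 < Real.cos θ) (hψ : 0 < Real.cos ψ)
    (hs : 0 < s) (hs1 : s < 1) :
    Integrable (Function.uncurry fun z r : ℝ => ((z^(s-1) : ℝ) : ℂ) * mwH α θ ψ z r)
      ((volume.restrict (Set.Ioi 0)).prod (volume.restrict (Set.Ioi 0))) := by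
  have hm : Measurable (Function.uncurry fun z r : ℝ => ((z^(s-1) : ℝ) : ℂ) * mwH α θ ψ z r) := by
    unfold Function.uncurry mwH; fun_prop
  have hn : ∀ r : ℝ, 0 < r → ∀ z ∈ Set.Ioi (0:ℝ),
      ‖((z^(s-1) : ℝ) : ℂ) * mwH α θ ψ z r‖ =
      (r^(α-1) * Real.exp (-Real.cos θ * r)) * (z^(s-1) * Real.exp (-((Real.cos ψ * r^α) * z))) := by
    intro r hr z hz
    have hz' : (0:ℝ) < z := hz
    rw [norm_mul, mwH_norm _ _ _ _ _ hr, Complex.norm_real, Real.norm_of_nonneg (by positivity),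
      show -(z * Real.cos ψ) * r^α = -((Real.cos ψ * r^α) * z) by ring]
    ring
  rw [integrable_prod_iff' hm.aestronglyMeasurable]
  constructor
  · filter_upwards [ae_restrict_mem measurableSet_Ioi] with r hr
    have hr' : (0:ℝ) < r := hr
    have hi := (mw_int1 (s-1) (Real.cos ψ * r^α) (by linarith) (by positivity)).const_mul
      (r^(α-1) * Real.exp (-Real.cos θ * r))
    refine hi.mono' (hm.comp (measurable_id.prodMk measurable_const)).aestronglyMeasurable ?_
    filter_upwards [ae_restrict_mem measurableSet_Ioi] with z hz
    refine (hn r hr' z hz).le.trans (le_of_eq ?_)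
    rw [neg_mul (Real.cos ψ * r^α)]
  · have hi := (mw_int1 (α - 1 - α * s) (Real.cos θ) (by nlinarith) hθ).const_mul
      ((Real.cos ψ)^(-s) * Real.Gamma s)
    refine hi.congr ?_
    filter_upwards [ae_restrict_mem measurableSet_Ioi] with r hr
    have hr' : (0:ℝ) < r := hr
    have := setIntegral_congr_fun (μ := volume) measurableSet_Ioi (hn r hr')
    refine Eq.trans ?_ this.symm
    rw [integral_const_mul, Real.integral_rpow_mul_exp_neg_mul_Ioi hs (by positivity),
      one_div, Real.inv_rpow (by positivity), ← Real.rpow_neg (by positivity),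
      Real.mul_rpow hψ.le (by positivity), ← Real.rpow_mul hr'.le,
      show α - 1 - α * s = (α - 1) + α * -s by ring, Real.rpow_add hr']
    ring

lemma mw_fub (α θ ψ s : ℝ) (hα : 0 < α) (h1 : -(π/2) < θ) (h2 : θ < π/2)
    (h3 : -(π/2) < ψ) (h4 : ψ < π/2) (hψ : ψ = α * (θ + π))
    (hs : 0 < s) (hs1 : s < 1) :
    ∫ z in Set.Ioi (0:ℝ), z^(s-1) * ((mwG α θ ψ z).im / π) =
      Real.Gamma s / Real.Gamma (1 - α + α * s) := by
  have hθ : 0 < Real.cos θ := Real.cos_pos_of_mem_Ioo ⟨h1, h2⟩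
  have hc : 0 < Real.cos ψ := Real.cos_pos_of_mem_Ioo ⟨h3, h4⟩
  have hI := mw_fub_int α θ ψ s hα hθ hc hs hs1
  have hsw := integral_integral_swap hI
  have hs' : 0 < α * (1 - s) := mul_pos hα (by linarith)
  have hin : ∀ r ∈ Set.Ioi (0:ℝ), ∫ z in Set.Ioi (0:ℝ), ((z^(s-1) : ℝ) : ℂ) * mwH α θ ψ z r =
      (Complex.exp ((ψ:ℂ) * Complex.I) * Complex.exp (((-(s*ψ) : ℝ) : ℂ) * Complex.I) *
        (Real.Gamma s : ℂ)) * (((r^(α * (1-s) - 1) : ℝ) : ℂ) * mwE θ 1 r) := by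
    intro r hr
    have hr' : (0:ℝ) < r := hr
    have : ∀ z ∈ Set.Ioi (0:ℝ), ((z^(s-1) : ℝ) : ℂ) * mwH α θ ψ z r =
      (Complex.exp ((ψ:ℂ) * Complex.I) * (((r^(α-1) : ℝ) : ℂ) * mwE θ 1 r)) *
        (((z^(s-1) : ℝ) : ℂ) * mwE ψ (r^α) z) := by
      intro z hz
      unfold mwH
      rw [mwE_symm ψ z]; ring
    rw [setIntegral_congr_fun measurableSet_Ioi this, integral_const_mul,
      mwE_gam ψ (r^α) s h3 h4 (by positivity) hs, ← Real.rpow_mul hr'.le,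
      show α * (1-s) - 1 = (α - 1) + α * -s by ring, Real.rpow_add hr']
    push_cast
    ring
  rw [setIntegral_congr_fun measurableSet_Ioi hin, integral_const_mul,
    mwE_gam θ 1 (α * (1-s)) h1 h2 one_pos hs', Real.one_rpow, one_mul] at hsw
  have hph : Complex.exp ((ψ:ℂ) * Complex.I) * Complex.exp (((-(s*ψ) : ℝ) : ℂ) * Complex.I) *
      (Real.Gamma s : ℂ) * ((Real.Gamma (α * (1-s)) : ℂ) *
        Complex.exp (((-(α * (1-s) * θ) : ℝ) : ℂ) * Complex.I)) =
      ((Real.Gamma s * Real.Gamma (α * (1-s)) : ℝ) : ℂ) *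
        Complex.exp (((π * (α * (1-s)) : ℝ) : ℂ) * Complex.I) := by
    have : Complex.exp (((π * (α * (1-s)) : ℝ) : ℂ) * Complex.I) =
      Complex.exp ((ψ:ℂ) * Complex.I) * Complex.exp (((-(s*ψ) : ℝ) : ℂ) * Complex.I) *
        Complex.exp (((-(α * (1-s) * θ) : ℝ) : ℂ) * Complex.I) := by
      rw [← Complex.exp_add, ← Complex.exp_add, hψ]; congr 1; push_cast; ring
    rw [this]; push_cast; ring
  rw [hph] at hsw
  have hint : Integrable (fun z : ℝ => ((z^(s-1) : ℝ) : ℂ) * mwG α θ ψ z)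
      (volume.restrict (Set.Ioi 0)) := by
    have := hI.integral_prod_left
    simpa only [Function.uncurry, integral_const_mul, mwG] using this
  simp only [integral_const_mul] at hsw
  have him := integral_im hint
  have hsw2 := congrArg Complex.im hsw
  rw [Complex.im_ofReal_mul, Complex.exp_ofReal_mul_I_im, mul_assoc, mw_reflect _ hs'] at hsw2
  have : ∀ z ∈ Set.Ioi (0:ℝ), z^(s-1) * ((mwG α θ ψ z).im / π) =
      π⁻¹ * RCLike.im (((z^(s-1) : ℝ) : ℂ) * mwG α θ ψ z) := by
    intro z hz
    change _ = π⁻¹ * Complex.im (((z^(s-1) : ℝ) : ℂ) * mwG α θ ψ z)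
    rw [Complex.im_ofReal_mul]; ring
  rw [setIntegral_congr_fun measurableSet_Ioi this, integral_const_mul, him]
  refine Eq.trans (congrArg (π⁻¹ * ·) hsw2) ?_
  have := Real.pi_ne_zero
  rw [show 1 - α + α * s = 1 - α * (1 - s) by ring]
  field_simp

lemma mw_mellin (α θ ψ : ℝ) (hα : 0 < α) (hα1 : α < 1) (h1 : -(π/2) < θ) (h2 : θ < π/2)
    (h3 : -(π/2) < ψ) (h4 : ψ < π/2) (hψ : ψ = α * (θ + π)) (s : ℂ) (hs : 0 < s.re) :
    mellin (fun z : ℝ => (((mwG α θ ψ z).im / π : ℝ) : ℂ)) s =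
      Complex.Gamma s * (Complex.Gamma (1 - α + α * s))⁻¹ := by
  have hθ : 0 < Real.cos θ := Real.cos_pos_of_mem_Ioo ⟨h1, h2⟩
  have hc : 0 < Real.cos ψ := Real.cos_pos_of_mem_Ioo ⟨h3, h4⟩
  have hopen : IsOpen {v : ℂ | 0 < v.re} := isOpen_lt continuous_const Complex.continuous_re
  have hcont : ContinuousOn (fun z : ℝ => (((mwG α θ ψ z).im / π : ℝ) : ℂ)) (Set.Ioi 0) := by
    have := mwG_cont α θ ψ hα hθ hc
    exact Complex.continuous_ofReal.comp_continuousOn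
      ((Complex.continuous_im.comp_continuousOn this).div_const _)
  have hloc := hcont.locallyIntegrableOn (μ := volume) measurableSet_Ioi
  have hf : AnalyticOnNhd ℂ (mellin (fun z : ℝ => (((mwG α θ ψ z).im / π : ℝ) : ℂ)))
      {v : ℂ | 0 < v.re} := by
    refine DifferentiableOn.analyticOnNhd (fun v hv => ?_) hopen
    have hv' : 0 < v.re := hv
    obtain ⟨K, hK⟩ := exists_nat_gt (α * v.re)
    refine (mellin_differentiableAt_of_isBigO_rpow (a := (α - 1 + K + 1) / α) (b := 0)
      hloc ?_ ?_ ?_ hv').differentiableWithinAt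
    · refine Asymptotics.IsBigO.of_bound ((Real.cos ψ)^(-(α - 1 + K + 1) / α) * (1/α) *
        Real.Gamma ((α - 1 + K + 1) / α) / π) ?_
      filter_upwards [Filter.eventually_gt_atTop 0] with z hz
      rw [Complex.norm_real, Real.norm_eq_abs, abs_div, abs_of_pos Real.pi_pos,
        Real.norm_of_nonneg (by positivity), div_mul_eq_mul_div]
      refine div_le_div_of_nonneg_right ?_ Real.pi_pos.le
      refine (mwG_decay α θ ψ z K hα hθ h3 h4 hψ hz).trans (le_of_eq ?_)
      rw [Real.mul_rpow hz.le hc.le, neg_div]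
      ring
    · rw [lt_div_iff₀ hα]; linarith
    · refine Asymptotics.IsBigO.of_bound
        ((∫ r in Set.Ioi (0:ℝ), r^(α-1) * Real.exp (-Real.cos θ * r)) / π) ?_
      filter_upwards [self_mem_nhdsWithin] with z hz
      have hz' : (0:ℝ) < z := hz
      rw [neg_zero, Real.rpow_zero, norm_one, mul_one, Complex.norm_real, Real.norm_eq_abs, abs_div,
        abs_of_pos Real.pi_pos]
      refine div_le_div_of_nonneg_right ?_ Real.pi_pos.le
      exact (Complex.abs_im_le_norm _).trans (mwG_bound α θ ψ z hα hθ hc hz'.le)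
  have hg : AnalyticOnNhd ℂ (fun s : ℂ => Complex.Gamma s * (Complex.Gamma (1 - α + α * s))⁻¹)
      {v : ℂ | 0 < v.re} := by
    refine DifferentiableOn.analyticOnNhd (fun v hv => ?_) hopen
    have hv' : 0 < v.re := hv
    have d1 : DifferentiableAt ℂ Complex.Gamma v := by
      refine Complex.differentiableAt_Gamma _ fun m hm => ?_
      rw [hm] at hv'
      simp at hv'
      have : (0:ℝ) ≤ m := m.cast_nonneg
      linarith
    have d2 : DifferentiableAt ℂ (fun s : ℂ => (Complex.Gamma (1 - α + α * s))⁻¹) v :=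
      (Complex.differentiable_one_div_Gamma (1 - α + α * v)).comp v
        (f := fun s : ℂ => 1 - (α:ℂ) + α * s) (by fun_prop)
    exact (d1.mul d2).differentiableWithinAt
  refine hf.eqOn_of_preconnected_of_frequently_eq hg (convex_halfSpace_re_gt 0).isPreconnected
    (z₀ := ((1/2 : ℝ) : ℂ)) (by simp) ?_ hs
  have ht : Filter.Tendsto (fun x : ℝ => (x:ℂ)) (nhdsWithin (1/2) {1/2}ᶜ)
      (nhdsWithin ((1/2 : ℝ) : ℂ) {((1/2 : ℝ) : ℂ)}ᶜ) := by
    refine tendsto_nhdsWithin_iff.2 ⟨?_, ?_⟩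
    · exact (Complex.continuous_ofReal.tendsto (1/2)).mono_left nhdsWithin_le_nhds
    · filter_upwards [self_mem_nhdsWithin] with x hx
      intro h
      exact hx (Complex.ofReal_injective h)
  refine ht.frequently (Filter.Eventually.frequently ?_)
  filter_upwards [nhdsWithin_le_nhds (Ioo_mem_nhds (a := (0:ℝ)) (b := 1) (by norm_num) (by norm_num))] with x hx
  have key := mw_fub α θ ψ x hα h1 h2 h3 h4 hψ hx.1 hx.2
  have e : Complex.Gamma (x:ℂ) * (Complex.Gamma (1 - α + α * (x:ℂ)))⁻¹ =
      ((Real.Gamma x / Real.Gamma (1 - α + α * x) : ℝ) : ℂ) := by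
    rw [show (1 - α + α * (x:ℂ)) = ((1 - α + α * x : ℝ) : ℂ) by push_cast; ring,
      Complex.Gamma_ofReal, Complex.Gamma_ofReal]
    push_cast
    rw [div_eq_mul_inv]
  rw [e, ← key, ← integral_complex_ofReal, mellin]
  refine setIntegral_congr_fun measurableSet_Ioi fun z hz => ?_
  have hz' : (0:ℝ) < z := hz
  simp only [smul_eq_mul]
  rw [Complex.ofReal_mul (z^(x-1)), Complex.ofReal_cpow hz'.le]
  push_cast
  rfl

lemma mw_moment (α : ℝ) (hα : 0 < α) (hα1 : α < 1)
    (Φ : ℝ → ℝ)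
    (hΦ : ∀ z : ℝ, Φ z = ∑' n : ℕ,
      (-z) ^ n / ((n.factorial : ℝ) * Real.Gamma (1 - α * (n + 1)))) (n : ℕ) :
    (∫ z in Set.Ioi (0:ℝ), z ^ n * Φ z) = Real.Gamma (n + 1) / Real.Gamma (α * n + 1) := by
  have hpi := Real.pi_pos
  obtain ⟨β, hβ⟩ : ∃ β : ℝ, β * (1 + α) = π := ⟨π / (1 + α), by field_simp⟩
  have hβ0 : 0 < β := by
    by_contra h
    nlinarith
  have b1 : π / 2 < β := by nlinarith
  have b2 : β < π := by nlinarith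
  have b3 : α * β < π / 2 := by nlinarith
  have b4 : 0 < α * β := by positivity
  have hs := fun z hz => mw_series α (β - π) (α * β) z hα hα1 (by linarith) (by linarith)
    (by ring) hz
  have hm := mw_mellin α (β - π) (α * β) hα hα1 (by linarith) (by linarith)
    (by linarith) (by linarith) (by ring) (n + 1)
    (by simp; positivity)
  rw [show (1 - α + α * ((n:ℂ) + 1)) = ((α * n + 1 : ℝ) : ℂ) by push_cast; ring,
    show ((n:ℂ) + 1) = ((n + 1 : ℝ) : ℂ) by push_cast; ring,
      Complex.Gamma_ofReal, Complex.Gamma_ofReal] at hm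
  apply Complex.ofReal_injective
  rw [Complex.ofReal_div, div_eq_mul_inv, ← hm, mellin, ← integral_complex_ofReal]
  refine setIntegral_congr_fun measurableSet_Ioi fun z hz => ?_
  have hz' : (0:ℝ) < z := hz
  simp only [smul_eq_mul]
  rw [hΦ, hs z hz'.le]
  push_cast
  rw [add_sub_cancel_right, Complex.cpow_natCast]

/-- Moments of the M-Wright function
`Φ_α(z) = Σ_{n≥0} (-z)^n/(n! Γ(1-α(n+1)))`: for `α ∈ (0,1)`,
`∫_0^∞ z Φ_α(z) dz = 1/Γ(α+1)` and more generally
`∫_0^∞ z^n Φ_α(z) dz = Γ(n+1)/Γ(αn+1)` for every integer `n ≥ 0`. -/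
theorem mWright_moments (α : ℝ) (hα : 0 < α) (hα1 : α < 1)
    (Φ : ℝ → ℝ)
    (hΦ : ∀ z : ℝ, Φ z = ∑' n : ℕ,
      (-z) ^ n / ((n.factorial : ℝ) * Real.Gamma (1 - α * (n + 1)))) :
    (∫ z in Set.Ioi (0:ℝ), z * Φ z) = 1 / Real.Gamma (α + 1) ∧
    ∀ n : ℕ, (∫ z in Set.Ioi (0:ℝ), z ^ n * Φ z) =
      Real.Gamma (n + 1) / Real.Gamma (α * n + 1) := by
  refine ⟨?_, mw_moment α hα hα1 Φ hΦ⟩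
  have h := mw_moment α hα hα1 Φ hΦ 1
  have h2 : Real.Gamma (1 + 1) = 1 := by
    rw [Real.Gamma_add_one one_ne_zero, Real.Gamma_one, mul_one]
  simpa [h2] using h
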